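/- arXiv:0804.0638 — 4 statements merged into one kernel-verified Lean document; each statement's English description precedes it below -/
import Mathlib

section
/- Let X be a well-ordered set, D(X) the free dialgebra over a field k, and let s ∈ D(X) be nonzero with leading term [s̄] under the deg-lex order. If [asb] is a normal s-diword (obtained by substituting s for the letter x_k of a normal diword x₋ₘ ⊢ ⋯ ⊢ x₀ ⊣ ⋯ ⊣ xₙ, with k = 0, or k < 0 and s left normed, or k > 0 and s right normed), then the leading term of the element [asb] ∈ D(X) is the normal diword [a[s̄]b] with underlying word a·s̄·b, whose center is the center of [s̄] if k = 0, and is the original center x₀ if k ≠ 0. -/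
universe u v

/-- A dialgebra over a field `k`: a `k`-vector space with two bilinear associative
products `lp` (written `⊢` in the paper) and `rp` (written `⊣`) satisfying the three
dialgebra axioms. -/
class Dialgebra (k : Type*) (D : Type*) [Field k] [AddCommGroup D] [Module k D] where
  lp : D → D → D
  rp : D → D → D
  lp_add_left : ∀ a b c : D, lp (a + b) c = lp a c + lp b c
  lp_add_right : ∀ a b c : D, lp a (b + c) = lp a b + lp a c
  lp_smul_left : ∀ (r : k) (a b : D), lp (r • a) b = r • lp a b
  lp_smul_right : ∀ (r : k) (a b : D), lp a (r • b) = r • lp a b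
  rp_add_left : ∀ a b c : D, rp (a + b) c = rp a c + rp b c
  rp_add_right : ∀ a b c : D, rp a (b + c) = rp a b + rp a c
  rp_smul_left : ∀ (r : k) (a b : D), rp (r • a) b = r • rp a b
  rp_smul_right : ∀ (r : k) (a b : D), rp a (r • b) = r • rp a b
  lp_assoc : ∀ a b c : D, lp (lp a b) c = lp a (lp b c)
  rp_assoc : ∀ a b c : D, rp (rp a b) c = rp a (rp b c)
  di1 : ∀ a b c : D, rp a (lp b c) = rp (rp a b) c
  di2 : ∀ a b c : D, lp (rp a b) c = lp a (lp b c)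
  di3 : ∀ a b c : D, lp a (rp b c) = rp (lp a b) c

/-- A Leibniz algebra over a field `k`: a `k`-vector space with a bilinear bracket
satisfying the Leibniz identity `[[a,b],c] = [[a,c],b] + [a,[b,c]]`. -/
class LeibnizAlgebra (k : Type*) (L : Type*) [Field k] [AddCommGroup L] [Module k L] where
  br : L → L → L
  br_add_left : ∀ a b c : L, br (a + b) c = br a c + br b c
  br_add_right : ∀ a b c : L, br a (b + c) = br a b + br a c
  br_smul_left : ∀ (r : k) (a b : L), br (r • a) b = r • br a b
  br_smul_right : ∀ (r : k) (a b : L), br a (r • b) = r • br a b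
  leibniz : ∀ a b c : L, br (br a b) c = br (br a c) b + br a (br b c)

/-- A normal diword over `X`: a nonempty word in `X` together with a marked letter
(its center), recorded as the letters to the left of the center, the center, and the
letters to the right of the center. -/
structure NDiword (X : Type*) where
  left : List X
  center : X
  right : List X

namespace NDiword

variable {X : Type*}

/-- The underlying (associative) word of a normal diword. -/
def word (u : NDiword X) : List X := u.left ++ u.center :: u.right

/-- Concatenation with center at the center of the second factor: the product `⊢`
on normal diwords. -/
def lconc (u v : NDiword X) : NDiword X := ⟨u.word ++ v.left, v.center, v.right⟩

/-- Concatenation with center at the center of the first factor: the product `⊣`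
on normal diwords. -/
def rconc (u v : NDiword X) : NDiword X := ⟨u.left, u.center, u.right ++ v.word⟩

/-- The deg-lex order on normal diwords: compare `wt([u]) = (n+m+1, m, x₋ₘ, …, xₙ)`
lexicographically. -/
def dlt [LinearOrder X] (u v : NDiword X) : Prop :=
  u.word.length < v.word.length ∨
    (u.word.length = v.word.length ∧
      (u.left.length < v.left.length ∨
        (u.left.length = v.left.length ∧ List.Lex (· < ·) u.word v.word)))

end NDiword

/-- The free dialgebra on `X` over `k`: the free `k`-vector space on the set of
normal diwords over `X`. -/
abbrev FreeDialg (k : Type*) [Field k] (X : Type*) := NDiword X →₀ k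

/-- The one-letter normal diword `ẋ`, as an element of the free dialgebra. -/
noncomputable def ofX (k : Type*) [Field k] {X : Type*} (x : X) : FreeDialg k X :=
  Finsupp.single ⟨[], x, []⟩ 1

section FreeDialgebra

variable {k : Type*} [Field k] {X : Type*}

/-- The product `⊢` on the free dialgebra, extended bilinearly from normal diwords. -/
noncomputable def lmul (f g : FreeDialg k X) : FreeDialg k X :=
  f.sum fun u a => g.sum fun v b => Finsupp.single (u.lconc v) (a * b)

/-- The product `⊣` on the free dialgebra, extended bilinearly from normal diwords. -/
noncomputable def rmul (f g : FreeDialg k X) : FreeDialg k X :=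
  f.sum fun u a => g.sum fun v b => Finsupp.single (u.rconc v) (a * b)

/-- `x₁ ⊢ (x₂ ⊢ (⋯ ⊢ t))` for a word `a = x₁x₂⋯` of letters. -/
noncomputable def lfold (a : List X) (t : FreeDialg k X) : FreeDialg k X :=
  a.foldr (fun x s => lmul (ofX k x) s) t

/-- `((t ⊣ x₁) ⊣ x₂) ⊣ ⋯` for a word `b = x₁x₂⋯` of letters. -/
noncomputable def rfold (t : FreeDialg k X) (b : List X) : FreeDialg k X :=
  b.foldl (fun s x => rmul s (ofX k x)) t

/-- `f` is left normed: every normal diword in its support has its center at the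
last letter. -/
def LeftNormed (f : FreeDialg k X) : Prop := ∀ u ∈ f.support, u.right = ([] : List X)

/-- `f` is right normed: every normal diword in its support has its center at the
first letter. -/
def RightNormed (f : FreeDialg k X) : Prop := ∀ u ∈ f.support, u.left = ([] : List X)

/-- `u` is the leading term (maximal term in the deg-lex order) of `f`. -/
def IsMaxTerm [LinearOrder X] (f : FreeDialg k X) (u : NDiword X) : Prop :=
  u ∈ f.support ∧ ∀ v ∈ f.support, v ≠ u → v.dlt u

/-- `f` is monic: its leading coefficient is `1`. -/
def Monic [LinearOrder X] (f : FreeDialg k X) : Prop :=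
  ∃ u, IsMaxTerm f u ∧ f u = 1

/-- A context for an `s`-diword `[asb]`: a normal diword with one letter `x_k`
removed, where `s` is to be substituted.  `center a b` is the case `k = 0` (so
`[asb] = a ⊢ ⋯ ⊢ s ⊣ ⋯ ⊣ b`); `left a w` is the case `k < 0` (so
`[asb] = a ⊢ ⋯ ⊢ s ⊢ [w]` with the center inside `w`); `right w b` is the case
`k > 0` (so `[asb] = [w] ⊣ s ⊣ ⋯ ⊣ b` with the center inside `w`). -/
inductive Ctx (X : Type*) where
  | center (a b : List X)
  | left (a : List X) (w : NDiword X)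
  | right (w : NDiword X) (b : List X)

/-- The `s`-diword `[asb]` determined by a context: substitute `s` into the context. -/
noncomputable def Ctx.eval (s : FreeDialg k X) : Ctx X → FreeDialg k X
  | Ctx.center a b => rfold (lfold a s) b
  | Ctx.left a w => lfold a (lmul s (Finsupp.single w 1))
  | Ctx.right w b => rfold (rmul (Finsupp.single w 1) s) b

/-- Substituting a normal diword `t` into a context gives a normal diword `[atb]`. -/
def Ctx.subst {X : Type*} (t : NDiword X) : Ctx X → NDiword X
  | Ctx.center a b => ⟨a ++ t.left, t.center, t.right ++ b⟩
  | Ctx.left a w => ⟨a ++ t.word ++ w.left, w.center, w.right⟩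
  | Ctx.right w b => ⟨w.left, w.center, w.right ++ t.word ++ b⟩

/-- `[asb]` is a normal `s`-diword: either `s` sits at the center (`k = 0`), or
`k < 0` and `s` is left normed, or `k > 0` and `s` is right normed. -/
def IsNormalFor (s : FreeDialg k X) : Ctx X → Prop
  | Ctx.center _ _ => True
  | Ctx.left _ _ => LeftNormed s
  | Ctx.right _ _ => RightNormed s

/-- Membership in the two-sided dialgebra ideal generated by `S`. -/
inductive IdealGen (S : Set (FreeDialg k X)) : FreeDialg k X → Prop
  | of {s : FreeDialg k X} : s ∈ S → IdealGen S s
  | zero : IdealGen S 0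
  | add {f g : FreeDialg k X} : IdealGen S f → IdealGen S g → IdealGen S (f + g)
  | smul (r : k) {f : FreeDialg k X} : IdealGen S f → IdealGen S (r • f)
  | lmul_left (g : FreeDialg k X) {f : FreeDialg k X} : IdealGen S f → IdealGen S (lmul g f)
  | lmul_right (g : FreeDialg k X) {f : FreeDialg k X} : IdealGen S f → IdealGen S (lmul f g)
  | rmul_left (g : FreeDialg k X) {f : FreeDialg k X} : IdealGen S f → IdealGen S (rmul g f)
  | rmul_right (g : FreeDialg k X) {f : FreeDialg k X} : IdealGen S f → IdealGen S (rmul f g)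

/-- The two-sided dialgebra ideal `Id(S)` generated by `S`, as a submodule. -/
def dialgIdeal (S : Set (FreeDialg k X)) : Submodule k (FreeDialg k X) where
  carrier := {f | IdealGen S f}
  add_mem' := fun hf hg => IdealGen.add hf hg
  zero_mem' := IdealGen.zero
  smul_mem' := fun r _ hf => IdealGen.smul r hf

end FreeDialgebra

section GSB

variable {k : Type*} [Field k] {X : Type*}

/-- `h` is a linear combination `Σᵢ αᵢ [aᵢsᵢbᵢ]` of `sᵢ`-diwords with `sᵢ ∈ S`, where
each pair `(sᵢ, [aᵢ⋅bᵢ])` satisfies the property `P`. -/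
def IsCombination (S : Set (FreeDialg k X)) (h : FreeDialg k X)
    (P : FreeDialg k X → Ctx X → Prop) : Prop :=
  ∃ (n : ℕ) (α : Fin n → k) (s : Fin n → FreeDialg k X) (c : Fin n → Ctx X),
    (∀ i, s i ∈ S) ∧ (∀ i, P (s i) (c i)) ∧
    h = ∑ i, α i • (c i).eval (s i)

/-- The composition of left multiplication `x ⊣ f` is trivial modulo `S`. -/
def TrivLMul [LinearOrder X] (S : Set (FreeDialg k X)) (x : X) (f : FreeDialg k X) : Prop :=
  IsCombination S (rmul (ofX k x) f) fun s c =>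
    IsNormalFor s c ∧ RightNormed s ∧ RightNormed (c.eval s) ∧
      ∀ u m, IsMaxTerm s u → IsMaxTerm (rmul (ofX k x) f) m →
        (c.subst u).word.length ≤ m.word.length

/-- The composition of right multiplication `f ⊢ x` is trivial modulo `S`. -/
def TrivRMul [LinearOrder X] (S : Set (FreeDialg k X)) (x : X) (f : FreeDialg k X) : Prop :=
  IsCombination S (lmul f (ofX k x)) fun s c =>
    IsNormalFor s c ∧ LeftNormed s ∧ LeftNormed (c.eval s) ∧
      ∀ u m, IsMaxTerm s u → IsMaxTerm (lmul f (ofX k x)) m →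
        (c.subst u).word.length ≤ m.word.length

/-- All compositions of left multiplication in `S` are trivial modulo `S`. -/
def LMulCompsTrivial [LinearOrder X] (S : Set (FreeDialg k X)) : Prop :=
  ∀ f ∈ S, ¬ RightNormed f → ∀ x : X, TrivLMul S x f

/-- All compositions of right multiplication in `S` are trivial modulo `S`. -/
def RMulCompsTrivial [LinearOrder X] (S : Set (FreeDialg k X)) : Prop :=
  ∀ f ∈ S, ¬ LeftNormed f → ∀ x : X, TrivRMul S x f

/-- `h` is trivial modulo `(S, [w])`: it is a combination of normal `S`-diwords with
leading normal diwords `< [w]`; moreover all the summands are right (resp. left)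
normed `S`-diwords whenever the side condition `rn` (resp. `ln`) holds. -/
def TrivBelowWith [LinearOrder X] (S : Set (FreeDialg k X)) (h : FreeDialg k X)
    (w : NDiword X) (rn ln : Prop) : Prop :=
  IsCombination S h fun s c =>
    IsNormalFor s c ∧ (∀ u, IsMaxTerm s u → (c.subst u).dlt w) ∧
      (rn → RightNormed s ∧ RightNormed (c.eval s)) ∧
      (ln → LeftNormed s ∧ LeftNormed (c.eval s))

/-- All compositions of inclusion among elements of `S` are trivial. -/
def InclCompsTrivial [LinearOrder X] (S : Set (FreeDialg k X)) : Prop :=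
  ∀ f ∈ S, ∀ g ∈ S, ∀ (fb gb : NDiword X) (c : Ctx X),
    IsMaxTerm f fb → IsMaxTerm g gb → IsNormalFor g c → fb = c.subst gb →
      TrivBelowWith S (f - c.eval g) fb
        (RightNormed f ∧ RightNormed g ∧ RightNormed (c.eval g))
        (LeftNormed f ∧ LeftNormed g ∧ LeftNormed (c.eval g))

/-- A context with no letters before the substituted polynomial (shape `[fb]`). -/
def Ctx.noLeft {X : Type*} : Ctx X → Prop
  | Ctx.center a _ => a = []
  | Ctx.left a _ => a = []
  | Ctx.right _ _ => False

/-- A context with no letters after the substituted polynomial (shape `[ag]`). -/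
def Ctx.noRight {X : Type*} : Ctx X → Prop
  | Ctx.center _ b => b = []
  | Ctx.right _ b => b = []
  | Ctx.left _ _ => False

/-- All compositions of intersection among elements of `S` are trivial. -/
def IntersectCompsTrivial [LinearOrder X] (S : Set (FreeDialg k X)) : Prop :=
  ∀ f ∈ S, ∀ g ∈ S, ∀ (fb gb : NDiword X) (cf cg : Ctx X),
    IsMaxTerm f fb → IsMaxTerm g gb → IsNormalFor f cf → IsNormalFor g cg →
    cf.noLeft → cg.noRight → cf.subst fb = cg.subst gb →
    (cf.subst fb).word.length < fb.word.length + gb.word.length →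
      TrivBelowWith S (cf.eval f - cg.eval g) (cf.subst fb)
        (RightNormed f ∧ RightNormed g ∧ RightNormed (cf.eval f) ∧ RightNormed (cg.eval g))
        (LeftNormed f ∧ LeftNormed g ∧ LeftNormed (cf.eval f) ∧ LeftNormed (cg.eval g))

/-- `S` is a Gröbner–Shirshov basis in the free dialgebra: `S` is monic and all
compositions (left multiplication, right multiplication, inclusion, intersection)
of elements of `S` are trivial. -/
def IsGSB [LinearOrder X] (S : Set (FreeDialg k X)) : Prop :=
  (∀ f ∈ S, Monic f) ∧ LMulCompsTrivial S ∧ RMulCompsTrivial S ∧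
    InclCompsTrivial S ∧ IntersectCompsTrivial S

/-- `Irr(S)`: the normal diwords that are not of the form `[a[s̄]b]` for any `s ∈ S`
and normal `s`-diword `[asb]`. -/
def IrrSet [LinearOrder X] (S : Set (FreeDialg k X)) : Set (NDiword X) :=
  {u | ¬ ∃ s ∈ S, ∃ (c : Ctx X) (sb : NDiword X),
    IsMaxTerm s sb ∧ IsNormalFor s c ∧ u = c.subst sb}

end GSB

theorem lexApp {X : Type*} [LinearOrder X] (x : List X) {u v : List X}
    (hl : u.length = v.length) (h : List.Lex (· < ·) u v) :
    List.Lex (· < ·) (u ++ x) (v ++ x) := by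
  induction h with
  | nil => simp at hl
  | cons h ih => exact List.Lex.cons (ih (by simpa using hl))
  | rel h => exact List.Lex.rel h

theorem lexPre {X : Type*} [LinearOrder X] (a : List X) {u v : List X}
    (h : List.Lex (· < ·) u v) : List.Lex (· < ·) (a ++ u) (a ++ v) := by
  induction a with
  | nil => exact h
  | cons y l ih => exact List.Lex.cons ih

theorem lexIrr {X : Type*} [LinearOrder X] (u : List X) : ¬ List.Lex (· < ·) u u := by
  induction u with
  | nil => intro h; cases h
  | cons y l ih =>
    intro h
    cases h with
    | cons h => exact ih h
    | rel h => exact lt_irrefl _ h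

theorem dltIrr {X : Type*} [LinearOrder X] (u : NDiword X) : ¬ u.dlt u := by
  rintro (h | ⟨_, h | ⟨_, h⟩⟩)
  · exact lt_irrefl _ h
  · exact lt_irrefl _ h
  · exact lexIrr _ h

theorem maxMap {k X : Type*} [Field k] [LinearOrder X] (s : FreeDialg k X) (sb : NDiword X)
    (hs : IsMaxTerm s sb) (φ : NDiword X → NDiword X)
    (h : ∀ u ∈ s.support, u.dlt sb → (φ u).dlt (φ sb)) :
    IsMaxTerm (Finsupp.mapDomain φ s) (φ sb) := by
  classical
  have hne : ∀ u ∈ s.support, u ≠ sb → φ u ≠ φ sb := by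
    intro u hu hus he
    have := h u hu (hs.2 u hu hus)
    rw [he] at this
    exact dltIrr _ this
  constructor
  · rw [Finsupp.mem_support_iff, Finsupp.mapDomain, Finsupp.sum, Finsupp.finsetSum_apply,
      Finset.sum_eq_single sb]
    · simpa using hs.1
    · intro u hu hus
      simp [Finsupp.single_apply, hne u hu hus]
    · intro hn
      exact absurd hs.1 hn
  · intro v hv hvs
    obtain ⟨u, hu, rfl⟩ := Finset.mem_image.1 (Finsupp.mapDomain_support hv)
    exact h u hu (hs.2 u hu (fun e => hvs (by rw [e])))

theorem lmul_single_left {k X : Type*} [Field k] (w : NDiword X) (s : FreeDialg k X) :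
    lmul (Finsupp.single w 1) s = Finsupp.mapDomain (fun u => w.lconc u) s := by
  simp [lmul, Finsupp.mapDomain, -Finsupp.single_mul]

theorem lmul_single_right {k X : Type*} [Field k] (w : NDiword X) (s : FreeDialg k X) :
    lmul s (Finsupp.single w 1) = Finsupp.mapDomain (fun u => u.lconc w) s := by
  simp [lmul, Finsupp.mapDomain, -Finsupp.single_mul]

theorem rmul_single_left {k X : Type*} [Field k] (w : NDiword X) (s : FreeDialg k X) :
    rmul (Finsupp.single w 1) s = Finsupp.mapDomain (fun u => w.rconc u) s := by
  simp [rmul, Finsupp.mapDomain, -Finsupp.single_mul]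

theorem rmul_single_right {k X : Type*} [Field k] (w : NDiword X) (s : FreeDialg k X) :
    rmul s (Finsupp.single w 1) = Finsupp.mapDomain (fun u => u.rconc w) s := by
  simp [rmul, Finsupp.mapDomain, -Finsupp.single_mul]

theorem lfold_eq {k X : Type*} [Field k] (a : List X) (s : FreeDialg k X) :
    lfold a s = Finsupp.mapDomain (fun u => ⟨a ++ u.left, u.center, u.right⟩) s := by
  induction a with
  | nil => exact Finsupp.mapDomain_id.symm
  | cons y l ih =>
    have : lfold (y :: l) s = lmul (ofX k y) (lfold l s) := rfl
    rw [this, ih, ofX, lmul_single_left, ← Finsupp.mapDomain_comp]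
    rfl

theorem rfold_eq {k X : Type*} [Field k] (b : List X) (s : FreeDialg k X) :
    rfold s b = Finsupp.mapDomain (fun u => ⟨u.left, u.center, u.right ++ b⟩) s := by
  induction b generalizing s with
  | nil =>
    simp only [List.append_nil]
    exact Finsupp.mapDomain_id.symm
  | cons y l ih =>
    have : rfold s (y :: l) = rfold (rmul s (ofX k y)) l := rfl
    rw [this, ih, ofX, rmul_single_right, ← Finsupp.mapDomain_comp]
    congr 1
    funext u
    simp [NDiword.rconc, NDiword.word]

theorem eval_eq {k X : Type*} [Field k] (c : Ctx X) (s : FreeDialg k X) :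
    c.eval s = Finsupp.mapDomain (fun u => c.subst u) s := by
  cases c with
  | center a b =>
    simp only [Ctx.eval]
    rw [lfold_eq, rfold_eq, ← Finsupp.mapDomain_comp]
    rfl
  | left a w =>
    simp only [Ctx.eval]
    rw [lfold_eq, lmul_single_right, ← Finsupp.mapDomain_comp]
    congr 1
    funext u
    simp [NDiword.lconc, Ctx.subst]
  | right w b =>
    simp only [Ctx.eval]
    rw [rfold_eq, rmul_single_left, ← Finsupp.mapDomain_comp]
    congr 1

theorem lexMid {X : Type*} [LinearOrder X] (a b : List X) {u v : List X}
    (hl : u.length = v.length) (h : List.Lex (· < ·) u v) :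
    List.Lex (· < ·) (a ++ (u ++ b)) (a ++ (v ++ b)) :=
  lexPre a (lexApp b hl h)

/-- for a normal `s`-diword `[asb]`, the leading term of the element
`[asb] ∈ D(X)` is the normal diword `[a[s̄]b]` obtained by substituting the leading
term `[s̄]` of `s` into the context. -/
theorem leading_term_of_normal_s_diword {k X : Type*} [Field k] [LinearOrder X]
    [WellFoundedLT X] (s : FreeDialg k X) (sb : NDiword X)
    (hs : IsMaxTerm s sb) (c : Ctx X) (hc : IsNormalFor s c) :
    IsMaxTerm (c.eval s) (c.subst sb) := by
  rw [eval_eq]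
  refine maxMap s sb hs (fun u => c.subst u) ?_
  intro u hu hlt
  have key : ∃ p q : List X, ∀ t : NDiword X, (c.subst t).word = p ++ (t.word ++ q) := by
    cases c with
    | center a b => exact ⟨a, b, fun t => by simp [Ctx.subst, NDiword.word]⟩
    | left a w => exact ⟨a, w.word, fun t => by simp [Ctx.subst, NDiword.word]⟩
    | right w b =>
      exact ⟨w.left ++ w.center :: w.right, b, fun t => by simp [Ctx.subst, NDiword.word]⟩
  obtain ⟨p, q, hpq⟩ := key
  simp only [NDiword.dlt, hpq]
  have hlen : ∀ t : NDiword X, t.word.length = t.left.length + t.right.length + 1 := by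
    intro t; simp [NDiword.word]; omega
  rcases hlt with h | ⟨h1, h⟩
  · left; simp only [List.length_append]; omega
  · right
    refine ⟨by simp only [List.length_append]; omega, ?_⟩
    have hu' := hlen u
    have hs' := hlen sb
    rcases h with h | ⟨h2, h⟩
    · cases c with
      | center a b => left; simp only [Ctx.subst, List.length_append]; omega
      | left a w =>
        have e1 := hc u hu
        have e2 := hc sb hs.1
        rw [e1] at hu'; rw [e2] at hs'
        simp only [List.length_nil] at hu' hs'
        omega
      | right w b =>
        have e2 := hc sb hs.1
        rw [e2] at h
        simp at h
    · refine Or.inr ⟨?_, lexMid p q h1 h⟩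
      cases c <;> simp only [Ctx.subst, List.length_append] <;> omega
end

section
/- Let X be a well-ordered set, D(X) the free dialgebra over a field k with the deg-lex order, and S ⊆ D(X) a set of monic polynomials. Then every h ∈ D(X) has a representation h = Σᵢ αᵢ [uᵢ] + Σⱼ βⱼ [aⱼsⱼbⱼ], where each [uᵢ] ∈ Irr(S), each [aⱼsⱼbⱼ] is a normal sⱼ-diword with sⱼ ∈ S, and the leading normal diwords are strictly decreasing: [a₁[s̄₁]b₁] > [a₂[s̄₂]b₂] > ⋯ > [aₙ[s̄ₙ]bₙ]. -/
universe u v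

theorem hp_lex_ctx {X : Type*} [LinearOrder X] (a b : List X) {u v : List X}
    (hl : u.length = v.length) (h : List.Lex (· < ·) u v) :
    List.Lex (· < ·) (a ++ u ++ b) (a ++ v ++ b) := by
  have h1 : List.Lex (· < ·) (u ++ b) (v ++ b) := by
    induction h with
    | nil => simp at hl
    | cons h ih => exact List.Lex.cons (ih (by simpa using hl))
    | rel h => exact List.Lex.rel h
  rw [List.append_assoc, List.append_assoc]
  induction a with
  | nil => exact h1
  | cons x a ih => exact List.Lex.cons ih

theorem hp_dlt_wf {X : Type*} [LinearOrder X] [WellFoundedLT X] :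
    WellFounded (NDiword.dlt (X := X)) := by
  have hs : WellFounded (List.Shortlex ((· < ·) : X → X → Prop)) :=
    List.Shortlex.wf wellFounded_lt
  have hw := WellFounded.prod_lex (Nat.lt_wfRel.wf) (WellFounded.prod_lex (Nat.lt_wfRel.wf) hs)
  refine Subrelation.wf ?_ (InvImage.wf
    (fun u : NDiword X => (u.word.length, (u.left.length, u.word))) hw)
  intro u v h
  rcases h with h | ⟨h1, h | ⟨h2, h3⟩⟩
  · exact Prod.Lex.left _ _ h
  · simp only [InvImage]
    rw [h1]; exact Prod.Lex.right _ (Prod.Lex.left _ _ h)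
  · simp only [InvImage]
    rw [h1, h2]
    exact Prod.Lex.right _ (Prod.Lex.right _ (List.Shortlex.of_lex h1 h3))

/-- weight -/
def hpWt {X : Type*} (u : NDiword X) : ℕ ×ₗ ℕ ×ₗ List X :=
  toLex (u.word.length, toLex (u.left.length, u.word))

theorem hpWt_inj {X : Type*} : Function.Injective (hpWt (X := X)) := by
  rintro ⟨a, x, b⟩ ⟨a', x', b'⟩ h
  simp only [hpWt, EmbeddingLike.apply_eq_iff_eq, Prod.mk.injEq, NDiword.word] at h
  obtain ⟨_, h1, h2⟩ := h
  obtain ⟨h3, h4⟩ := List.append_inj h2 h1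
  simp_all

theorem hpWt_lt {X : Type*} [LinearOrder X] (u v : NDiword X) :
    hpWt u < hpWt v ↔ u.dlt v := by
  simp only [hpWt, NDiword.dlt, Prod.Lex.toLex_lt_toLex]
  rfl

theorem hp_dlt_asymm {X : Type*} [LinearOrder X] {u v : NDiword X} (h : u.dlt v) :
    ¬ v.dlt u := by
  rw [← hpWt_lt] at *
  exact lt_asymm h

theorem hp_lmul_x {k X : Type*} [Field k] (x : X) (s : FreeDialg k X) :
    lmul (ofX k x) s = s.mapDomain (fun t => ⟨x :: t.left, t.center, t.right⟩) := by
  unfold lmul ofX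
  rw [Finsupp.sum_single_index (by simp)]
  simp [Finsupp.mapDomain, NDiword.lconc, NDiword.word]

theorem hp_rmul_x {k X : Type*} [Field k] (x : X) (s : FreeDialg k X) :
    rmul s (ofX k x) = s.mapDomain (fun t => ⟨t.left, t.center, t.right ++ [x]⟩) := by
  unfold rmul ofX Finsupp.mapDomain
  refine Finsupp.sum_congr fun u _ => ?_
  rw [Finsupp.sum_single_index (by simp)]
  simp [NDiword.rconc, NDiword.word]

theorem hp_lfold {k X : Type*} [Field k] (a : List X) (s : FreeDialg k X) :
    lfold a s = s.mapDomain (fun t => ⟨a ++ t.left, t.center, t.right⟩) := by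
  induction a with
  | nil => exact Finsupp.mapDomain_id.symm
  | cons x a ih =>
    change lmul (ofX k x) (lfold a s) = _
    rw [hp_lmul_x, ih, ← Finsupp.mapDomain_comp]
    rfl

theorem hp_rfold {k X : Type*} [Field k] (b : List X) (s : FreeDialg k X) :
    rfold s b = s.mapDomain (fun t => ⟨t.left, t.center, t.right ++ b⟩) := by
  induction b generalizing s with
  | nil =>
    simp only [List.append_nil]
    exact Finsupp.mapDomain_id.symm
  | cons x b ih =>
    change rfold (rmul s (ofX k x)) b = _
    rw [ih, hp_rmul_x, ← Finsupp.mapDomain_comp]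
    congr 1
    funext t
    simp

theorem hp_eval {k X : Type*} [Field k] (c : Ctx X) (s : FreeDialg k X) :
    c.eval s = s.mapDomain (fun t => c.subst t) := by
  cases c with
  | center a b =>
    simp only [Ctx.eval, hp_lfold, hp_rfold]
    rw [← Finsupp.mapDomain_comp]; rfl
  | left a w =>
    have : lmul s (Finsupp.single w 1) = s.mapDomain (fun t => t.lconc w) := by
      unfold lmul Finsupp.mapDomain
      refine Finsupp.sum_congr fun u _ => ?_
      rw [Finsupp.sum_single_index (by simp)]
      simp
    simp only [Ctx.eval, this, hp_lfold]
    rw [← Finsupp.mapDomain_comp]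
    congr 1
    funext t
    simp [NDiword.lconc, Ctx.subst]
  | right w b =>
    have : rmul (Finsupp.single w 1) s = s.mapDomain (fun t => w.rconc t) := by
      unfold rmul Finsupp.mapDomain
      rw [Finsupp.sum_single_index (by simp)]
      simp
    simp only [Ctx.eval, this, hp_rfold]
    rw [← Finsupp.mapDomain_comp]
    congr 1

theorem hp_mono {k X : Type*} [Field k] [LinearOrder X] {c : Ctx X} {s : FreeDialg k X}
    (hn : IsNormalFor s c) {t v : NDiword X} (ht : t ∈ s.support) (hv : v ∈ s.support)
    (h : t.dlt v) : (c.subst t).dlt (c.subst v) := by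
  cases c with
  | center a b =>
    have e : ∀ t : NDiword X, ((Ctx.center a b).subst t).word = a ++ t.word ++ b := by
      intro t; simp [Ctx.subst, NDiword.word]
    rcases h with h | ⟨h1, h | ⟨h2, h3⟩⟩
    · left; simp only [e, List.length_append]; omega
    · right; refine ⟨by simp only [e, List.length_append]; omega, Or.inl ?_⟩
      simpa [Ctx.subst] using h
    · right; refine ⟨by simp only [e, List.length_append]; omega, Or.inr ⟨?_, ?_⟩⟩
      · simpa [Ctx.subst] using h2
      · rw [e, e]; exact hp_lex_ctx a b h1 h3
  | left a w =>
    have e : ∀ t : NDiword X, ((Ctx.left a w).subst t).word = a ++ t.word ++ w.word := by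
      intro t; simp [Ctx.subst, NDiword.word]
    have r1 := hn t ht
    have r2 := hn v hv
    have l1 : t.word.length = t.left.length + 1 := by simp [NDiword.word, r1]
    have l2 : v.word.length = v.left.length + 1 := by simp [NDiword.word, r2]
    rcases h with h | ⟨h1, h | ⟨h2, h3⟩⟩
    · left; simp only [e, List.length_append]; omega
    · omega
    · right; refine ⟨by simp only [e, List.length_append]; omega, Or.inr ⟨?_, ?_⟩⟩
      · simpa [Ctx.subst] using h1
      · rw [e, e]; exact hp_lex_ctx a w.word h1 h3
  | right w b =>
    have e : ∀ t : NDiword X, ((Ctx.right w b).subst t).word = w.word ++ t.word ++ b := by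
      intro t; simp [Ctx.subst, NDiword.word]
    have r1 := hn t ht
    have r2 := hn v hv
    rcases h with h | ⟨h1, h | ⟨h2, h3⟩⟩
    · left; simp only [e, List.length_append]; omega
    · simp [r1, r2] at h
    · right; refine ⟨by simp only [e, List.length_append]; omega, Or.inr ⟨rfl, ?_⟩⟩
      rw [e, e]; exact hp_lex_ctx w.word b h1 h3

/-- every element of the free dialgebra is a linear combination of
irreducible normal diwords and of normal `S`-diwords with strictly decreasing
leading normal diwords. -/
theorem exists_irr_plus_decreasing_rep {k X : Type*} [Field k] [LinearOrder X]
    [WellFoundedLT X] (S : Set (FreeDialg k X)) (hmonic : ∀ f ∈ S, Monic f)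
    (h : FreeDialg k X) :
    ∃ (n : ℕ) (α : Fin n → k) (u : Fin n → NDiword X)
      (m : ℕ) (β : Fin m → k) (s : Fin m → FreeDialg k X) (c : Fin m → Ctx X)
      (sb : Fin m → NDiword X),
      (∀ i, u i ∈ IrrSet S) ∧ (∀ j, s j ∈ S) ∧
      (∀ j, IsNormalFor (s j) (c j)) ∧ (∀ j, IsMaxTerm (s j) (sb j)) ∧
      (∀ j j' : Fin m, j < j' → ((c j').subst (sb j')).dlt ((c j).subst (sb j))) ∧
      h = (∑ i, α i • Finsupp.single (u i) 1) + ∑ j, β j • (c j).eval (s j) := by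
  classical
  have hch : ∀ w : NDiword X, ∃ (s : FreeDialg k X) (c : Ctx X) (sb : NDiword X),
      w ∉ IrrSet S → (s ∈ S ∧ IsMaxTerm s sb ∧ IsNormalFor s c ∧ w = c.subst sb) := by
    intro w
    by_cases hw : w ∈ IrrSet S
    · exact ⟨0, Ctx.center [] [], w, fun h => absurd hw h⟩
    · have hw' := hw
      simp only [IrrSet, Set.mem_ofPred_eq, not_not] at hw'
      obtain ⟨s, hs, c, sb, h1, h2, h3⟩ := hw'
      exact ⟨s, c, sb, fun _ => ⟨hs, h1, h2, h3⟩⟩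
  choose s c sb hprop using hch
  let e : NDiword X → FreeDialg k X := fun w =>
    if w ∈ IrrSet S then Finsupp.single w 1 else (c w).eval (s w)
  have hspan : ∀ w : NDiword X,
      (Finsupp.single w 1 : FreeDialg k X) ∈ Submodule.span k (Set.range e) := by
    intro w0
    refine hp_dlt_wf.induction (C := fun w => (Finsupp.single w 1 : FreeDialg k X) ∈
      Submodule.span k (Set.range e)) w0 ?_
    intro w ih
    by_cases hw : w ∈ IrrSet S
    · exact Submodule.subset_span ⟨w, by simp [e, hw]⟩
    · obtain ⟨hs, hm, hn, hwe⟩ := hprop w hw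
      have h1 : s w (sb w) = 1 := by
        obtain ⟨u, hu, hu1⟩ := hmonic _ hs
        by_cases hne : u = sb w
        · rw [← hne]; exact hu1
        · exact absurd (hu.2 _ hm.1 (Ne.symm hne)) (hp_dlt_asymm (hm.2 _ hu.1 hne))
      have h2 : (c w).eval (s w) = Finsupp.single w 1 +
          ∑ t ∈ (s w).support.erase (sb w), s w t • Finsupp.single ((c w).subst t) 1 := by
        rw [hp_eval, Finsupp.mapDomain, Finsupp.sum, ← Finset.add_sum_erase _ _ hm.1, h1, ← hwe]
        simp
      have h3 : (Finsupp.single w 1 : FreeDialg k X) = (c w).eval (s w) -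
          ∑ t ∈ (s w).support.erase (sb w), s w t • Finsupp.single ((c w).subst t) 1 := by
        rw [h2]; simp
      rw [h3]
      refine Submodule.sub_mem _ (Submodule.subset_span ⟨w, by simp [e, hw]⟩)
        (Submodule.sum_mem _ fun t ht => Submodule.smul_mem _ _ (ih _ ?_))
      rw [Finset.mem_erase] at ht
      have := hp_mono hn ht.2 hm.1 (hm.2 t ht.2 ht.1)
      rw [← hwe] at this
      exact this
  have hh : h ∈ Submodule.span k (Set.range e) := by
    rw [← Finsupp.sum_single h]
    refine Submodule.sum_mem _ fun t _ => ?_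
    rw [← mul_one (h t), ← smul_eq_mul, ← Finsupp.smul_single]
    exact Submodule.smul_mem _ _ (hspan t)
  obtain ⟨a, ha⟩ := (Finsupp.mem_span_range_iff_exists_finsupp).1 hh
  let L : LinearOrder (NDiword X) := LinearOrder.lift' hpWt hpWt_inj
  let T := a.support.filter (fun w => w ∈ IrrSet S)
  let R := a.support.filter (fun w => w ∉ IrrSet S)
  let φ := R.orderIsoOfFin rfl
  have hR : ∀ j, ((φ j : NDiword X)) ∉ IrrSet S := fun j => (Finset.mem_filter.1 (φ j).2).2
  refine ⟨T.card, fun i => a (T.equivFin.symm i), fun i => T.equivFin.symm i, R.card,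
    fun j => a (φ j.rev), fun j => s (φ j.rev), fun j => c (φ j.rev), fun j => sb (φ j.rev),
    fun i => (Finset.mem_filter.1 (T.equivFin.symm i).2).2, fun j => (hprop _ (hR _)).1,
    fun j => (hprop _ (hR _)).2.2.1, fun j => (hprop _ (hR _)).2.1, ?_, ?_⟩
  · intro j j' hj
    rw [← (hprop _ (hR _)).2.2.2, ← (hprop _ (hR _)).2.2.2, ← hpWt_lt]
    exact φ.strictMono (Fin.rev_lt_rev.2 hj)
  · have hT : ∑ i, a (T.equivFin.symm i) • (Finsupp.single (T.equivFin.symm i : NDiword X) 1 : FreeDialg k X)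
        = ∑ w ∈ T, a w • e w := by
      rw [Equiv.sum_comp T.equivFin.symm (fun w : T => a w • (Finsupp.single (w : NDiword X) 1 : FreeDialg k X)),
        Finset.sum_coe_sort T (fun w => a w • (Finsupp.single w 1 : FreeDialg k X))]
      refine Finset.sum_congr rfl fun w hw => ?_
      simp only [e]
      rw [if_pos (Finset.mem_filter.1 hw).2]
    have hRs : ∑ j : Fin R.card, a (φ j.rev) • (c (φ j.rev)).eval (s (φ j.rev))
        = ∑ w ∈ R, a w • e w := by
      refine (Equiv.sum_comp Fin.revPerm
        (fun j => a (φ j) • (c (φ j)).eval (s (φ j)))).trans ?_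
      refine (Equiv.sum_comp φ.toEquiv (fun w : R => a w • (c w).eval (s w))).trans ?_
      rw [Finset.sum_coe_sort R (fun w => a w • (c w).eval (s w))]
      refine Finset.sum_congr rfl fun w hw => ?_
      simp only [e]
      rw [if_neg (Finset.mem_filter.1 hw).2]
    rw [hT, hRs, ← ha, Finsupp.sum]
    exact (Finset.sum_filter_add_sum_filter_not _ _ _).symm
end

section
/- (Composition–Diamond lemma, (ii) ⇔ (iii).) Let X be a well-ordered set, D(X) the free dialgebra over a field k with the deg-lex order, and S ⊆ D(X) a monic set. Then the following are equivalent: (ii) for every nonzero f ∈ Id(S), the leading term satisfies [f̄] = [a[s̄]b] for some s ∈ S and words a, b with [asb] a normal s-diword; (iii) the images of the elements of Irr(S) form a k-linear basis of the quotient dialgebra D(X)/Id(S). -/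
universe u v

/-- The family of images of the irreducible normal diwords in the quotient
dialgebra `D(X | S)`. -/
noncomputable def irrFam {k X : Type*} [Field k] [LinearOrder X]
    (S : Set (FreeDialg k X)) :
    {u : NDiword X // u ∈ IrrSet S} → (FreeDialg k X ⧸ dialgIdeal S) :=
  fun u => Submodule.Quotient.mk (Finsupp.single u.1 1)

section CDHelpers

variable {k : Type*} [Field k] {X : Type*}

theorem cd_lmul_single_left (u : NDiword X) (f : FreeDialg k X) :
    lmul (Finsupp.single u 1) f = f.mapDomain (fun v => u.lconc v) := by
  unfold lmul
  rw [Finsupp.sum_single_index]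
  · simp [Finsupp.mapDomain]
  · simp

theorem cd_lmul_single_right (u : NDiword X) (f : FreeDialg k X) :
    lmul f (Finsupp.single u 1) = f.mapDomain (fun v => v.lconc u) := by
  unfold lmul Finsupp.mapDomain
  refine Finsupp.sum_congr fun v _ => ?_
  rw [Finsupp.sum_single_index] <;> simp

theorem cd_rmul_single_left (u : NDiword X) (f : FreeDialg k X) :
    rmul (Finsupp.single u 1) f = f.mapDomain (fun v => u.rconc v) := by
  unfold rmul
  rw [Finsupp.sum_single_index]
  · simp [Finsupp.mapDomain]
  · simp

theorem cd_rmul_single_right (u : NDiword X) (f : FreeDialg k X) :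
    rmul f (Finsupp.single u 1) = f.mapDomain (fun v => v.rconc u) := by
  unfold rmul Finsupp.mapDomain
  refine Finsupp.sum_congr fun v _ => ?_
  rw [Finsupp.sum_single_index] <;> simp

theorem cd_lfold (a : List X) (t : FreeDialg k X) :
    lfold a t = t.mapDomain (fun u => ⟨a ++ u.left, u.center, u.right⟩) := by
  induction a with
  | nil =>
    show t = _
    exact (Finsupp.mapDomain_id (v := t)).symm
  | cons x a ih =>
    show lmul (ofX k x) (lfold a t) = _
    rw [ih, ofX, cd_lmul_single_left, ← Finsupp.mapDomain_comp]
    rfl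

theorem cd_rfold (b : List X) (t : FreeDialg k X) :
    rfold t b = t.mapDomain (fun u => ⟨u.left, u.center, u.right ++ b⟩) := by
  induction b generalizing t with
  | nil =>
    show t = _
    simp only [List.append_nil]
    exact (Finsupp.mapDomain_id (v := t)).symm
  | cons x b ih =>
    show rfold (rmul t (ofX k x)) b = _
    rw [ih, ofX, cd_rmul_single_right, ← Finsupp.mapDomain_comp]
    congr 1
    funext u
    simp [NDiword.rconc, NDiword.word]

theorem cd_eval (s : FreeDialg k X) (c : Ctx X) :
    c.eval s = s.mapDomain (fun u => c.subst u) := by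
  cases c with
  | center a b =>
    simp only [Ctx.eval, cd_lfold, cd_rfold, ← Finsupp.mapDomain_comp]
    rfl
  | left a w =>
    simp only [Ctx.eval, cd_lfold, cd_lmul_single_right, ← Finsupp.mapDomain_comp]
    congr 1
    funext u
    simp [NDiword.lconc, Ctx.subst]
  | right w b =>
    simp only [Ctx.eval, cd_rfold, cd_rmul_single_left, ← Finsupp.mapDomain_comp]
    congr 1

theorem cd_lfold_mem (S : Set (FreeDialg k X)) (a : List X) (t : FreeDialg k X)
    (h : IdealGen S t) : IdealGen S (lfold a t) := by
  induction a with
  | nil => exact h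
  | cons x a ih => exact IdealGen.lmul_left _ ih

theorem cd_rfold_mem (S : Set (FreeDialg k X)) (b : List X) (t : FreeDialg k X)
    (h : IdealGen S t) : IdealGen S (rfold t b) := by
  induction b generalizing t with
  | nil => exact h
  | cons x b ih => exact ih _ (IdealGen.rmul_right _ h)

theorem cd_eval_mem (S : Set (FreeDialg k X)) (s : FreeDialg k X) (hs : s ∈ S) (c : Ctx X) :
    c.eval s ∈ dialgIdeal S := by
  show IdealGen S _
  have h := IdealGen.of hs
  cases c with
  | center a b => exact cd_rfold_mem S b _ (cd_lfold_mem S a _ h)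
  | left a w => exact cd_lfold_mem S a _ (IdealGen.lmul_right _ h)
  | right w b => exact cd_rfold_mem S b _ (IdealGen.rmul_left _ h)

variable [LinearOrder X]

theorem cd_lex_append_left (a u v : List X) (h : List.Lex (· < ·) u v) :
    List.Lex (· < ·) (a ++ u) (a ++ v) := by
  induction a with
  | nil => exact h
  | cons x a ih => exact List.Lex.cons ih

theorem cd_lex_append_right (b u v : List X) (hl : u.length = v.length)
    (h : List.Lex (· < ·) u v) : List.Lex (· < ·) (u ++ b) (v ++ b) := by
  induction h with
  | nil => simp at hl
  | rel h => exact List.Lex.rel h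
  | cons h ih => exact List.Lex.cons (ih (by simpa using hl))

theorem cd_subst_lt (s : FreeDialg k X) (c : Ctx X) (hc : IsNormalFor s c) (u v : NDiword X)
    (hu : u ∈ s.support) (hv : v ∈ s.support) (h : u.dlt v) :
    (c.subst u).dlt (c.subst v) := by
  cases c with
  | center a b =>
    have key : ∀ t : NDiword X, (Ctx.subst t (Ctx.center a b)).word = a ++ (t.word ++ b) := by
      intro t; simp [Ctx.subst, NDiword.word]
    have key2 : ∀ t : NDiword X, (Ctx.subst t (Ctx.center a b)).left = a ++ t.left := by
      intro t; simp [Ctx.subst]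
    unfold NDiword.dlt at h ⊢
    simp only [key, key2, List.length_append]
    rcases h with h | ⟨h1, h | ⟨h2, h3⟩⟩
    · left; omega
    · right; exact ⟨by omega, Or.inl (by omega)⟩
    · right
      exact ⟨by omega, Or.inr ⟨by omega,
        cd_lex_append_left _ _ _ (cd_lex_append_right _ _ _ h1 h3)⟩⟩
  | left a w =>
    have key : ∀ t : NDiword X, (Ctx.subst t (Ctx.left a w)).word = a ++ (t.word ++ w.word) := by
      intro t; simp [Ctx.subst, NDiword.word]
    have key2 : ∀ t : NDiword X,
        (Ctx.subst t (Ctx.left a w)).left = a ++ t.word ++ w.left := by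
      intro t; simp [Ctx.subst]
    have hl : ∀ t ∈ s.support, t.word.length = t.left.length + 1 := by
      intro t ht
      have := hc t ht
      simp [NDiword.word, this]
    have hu' := hl u hu
    have hv' := hl v hv
    unfold NDiword.dlt at h ⊢
    simp only [key, key2, List.length_append]
    rcases h with h | ⟨h1, h | ⟨h2, h3⟩⟩
    · left; omega
    · omega
    · right
      exact ⟨by omega, Or.inr ⟨by omega,
        cd_lex_append_left _ _ _ (cd_lex_append_right _ _ _ h1 h3)⟩⟩
  | right w b =>
    have key : ∀ t : NDiword X, (Ctx.subst t (Ctx.right w b)).word = w.word ++ (t.word ++ b) := by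
      intro t; simp [Ctx.subst, NDiword.word]
    have key2 : ∀ t : NDiword X, (Ctx.subst t (Ctx.right w b)).left = w.left := by
      intro t; simp [Ctx.subst]
    have hu' := hc u hu
    have hv' := hc v hv
    unfold NDiword.dlt at h ⊢
    simp only [key, key2, List.length_append]
    rcases h with h | ⟨h1, h | ⟨h2, h3⟩⟩
    · left; omega
    · simp [hu', hv'] at h
    · right
      exact ⟨by omega, Or.inr ⟨by trivial,
        cd_lex_append_left _ _ _ (cd_lex_append_right _ _ _ h1 h3)⟩⟩

/-- The weight as an element of a linear order. -/
def cdWt (u : NDiword X) : ℕ ×ₗ ℕ ×ₗ List X :=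
  toLex (u.word.length, toLex (u.left.length, u.word))

theorem cd_dlt_iff (u v : NDiword X) : u.dlt v ↔ cdWt u < cdWt v := by
  unfold cdWt NDiword.dlt
  rw [Prod.Lex.toLex_lt_toLex, Prod.Lex.toLex_lt_toLex]
  rfl

theorem cd_wt_inj (u v : NDiword X) (h : cdWt u = cdWt v) : u = v := by
  have h' : u.left.length = v.left.length ∧ u.word = v.word := by
    have h1 := congrArg (fun t => (ofLex (ofLex t).2)) h
    simpa [cdWt] using h1
  obtain ⟨h1, h2⟩ := h'
  cases u; cases v
  simp only [NDiword.word] at h1 h2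
  obtain ⟨h3, h4⟩ := List.append_inj h2 h1
  simp_all

theorem cd_wf [WellFoundedLT X] : WellFounded (NDiword.dlt (X := X)) := by
  have hs : WellFounded (List.Shortlex (· < · : X → X → Prop)) :=
    List.Shortlex.wf wellFounded_lt
  have hp : WellFounded (Prod.Lex (· < · : ℕ → ℕ → Prop)
      (Prod.Lex (· < · : ℕ → ℕ → Prop) (List.Shortlex (· < · : X → X → Prop)))) :=
    WellFounded.prod_lex wellFounded_lt (WellFounded.prod_lex wellFounded_lt hs)
  refine Subrelation.wf ?_ (InvImage.wf
    (fun u : NDiword X => (u.word.length, (u.left.length, u.word))) hp)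
  intro u v h
  show Prod.Lex _ _ _ _
  rw [Prod.lex_def]
  rcases h with h | ⟨h1, h⟩
  · exact Or.inl h
  · refine Or.inr ⟨h1, ?_⟩
    rw [Prod.lex_def]
    rcases h with h | ⟨h2, h3⟩
    · exact Or.inl h
    · exact Or.inr ⟨h2, List.Shortlex.of_lex h1 h3⟩

theorem cd_exists_max (f : FreeDialg k X) (hf : f ≠ 0) : ∃ u, IsMaxTerm f u := by
  obtain ⟨u, hu, hm⟩ := Finset.exists_max_image f.support cdWt
    (Finsupp.support_nonempty_iff.mpr hf)
  refine ⟨u, hu, fun v hv hne => ?_⟩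
  rw [cd_dlt_iff]
  exact lt_of_le_of_ne (hm v hv) (fun h => hne (cd_wt_inj _ _ h))

/-- Combinations of irreducible diwords of weight at most that of `u`, modulo the ideal. -/
noncomputable def cdN (S : Set (FreeDialg k X)) (u : NDiword X) :
    Submodule k (FreeDialg k X) :=
  Finsupp.supported k k {v | v ∈ IrrSet S ∧ cdWt v ≤ cdWt u} ⊔ dialgIdeal S

theorem cdN_mono (S : Set (FreeDialg k X)) (u v : NDiword X) (h : cdWt u ≤ cdWt v) :
    cdN S u ≤ cdN S v :=
  sup_le_sup_right (Finsupp.supported_mono (s := {w | w ∈ IrrSet S ∧ cdWt w ≤ cdWt u})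
    (t := {w | w ∈ IrrSet S ∧ cdWt w ≤ cdWt v}) fun _ hw => ⟨hw.1, hw.2.trans h⟩) _

theorem cd_reduce [WellFoundedLT X] (S : Set (FreeDialg k X)) (hmonic : ∀ f ∈ S, Monic f)
    (u : NDiword X) : Finsupp.single u (1 : k) ∈ cdN S u := by
  classical
  refine cd_wf.induction (C := fun u => Finsupp.single u (1 : k) ∈ cdN S u) u ?_
  intro u ih
  by_cases hu : u ∈ IrrSet S
  · exact Submodule.mem_sup_left (Finsupp.single_mem_supported k 1 ⟨hu, le_rfl⟩)
  · have hu' : ∃ s ∈ S, ∃ (c : Ctx X) (sb : NDiword X),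
        IsMaxTerm s sb ∧ IsNormalFor s c ∧ u = c.subst sb := by
      by_contra h; exact hu h
    obtain ⟨s, hs, c, sb, hsb, hc, rfl⟩ := hu'
    obtain ⟨sb', hsb', h1⟩ := hmonic s hs
    have hsbeq : sb = sb' := by
      by_contra hne
      have h2 := (cd_dlt_iff _ _).1 (hsb.2 sb' hsb'.1 (Ne.symm hne))
      have h3 := (cd_dlt_iff _ _).1 (hsb'.2 sb hsb.1 hne)
      exact lt_asymm h2 h3
    subst hsbeq
    have he : c.eval s = Finsupp.single (c.subst sb) 1 +
        ∑ v ∈ s.support.erase sb, s v • Finsupp.single (c.subst v) (1 : k) := by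
      rw [cd_eval, Finsupp.mapDomain, Finsupp.sum, ← Finset.add_sum_erase _ _ hsb.1, h1]
      simp
    have he' : Finsupp.single (c.subst sb) (1 : k) = c.eval s -
        ∑ v ∈ s.support.erase sb, s v • Finsupp.single (c.subst v) (1 : k) := by
      rw [he]; abel
    rw [he']
    refine Submodule.sub_mem _ (Submodule.mem_sup_right (cd_eval_mem S s hs c)) ?_
    refine Submodule.sum_mem _ fun v hv => Submodule.smul_mem _ _ ?_
    rw [Finset.mem_erase] at hv
    have hlt := cd_subst_lt s c hc v sb hv.2 hsb.1 (hsb.2 v hv.2 hv.1)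
    exact cdN_mono S _ _ ((cd_dlt_iff _ _).1 hlt).le (ih _ hlt)

theorem cd_linComb (S : Set (FreeDialg k X)) (l : {u : NDiword X // u ∈ IrrSet S} →₀ k) :
    Finsupp.linearCombination k (irrFam S) l =
      (dialgIdeal S).mkQ (l.mapDomain Subtype.val) := by
  rw [Finsupp.linearCombination_apply, Finsupp.mapDomain, Finsupp.sum, Finsupp.sum, map_sum]
  refine Finset.sum_congr rfl fun u _ => ?_
  have : Finsupp.single u.1 (l u) = l u • Finsupp.single u.1 (1 : k) := by simp
  rw [this, map_smul]
  rfl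

theorem cd_li_iff (S : Set (FreeDialg k X)) : LinearIndependent k (irrFam S) ↔
    ∀ g ∈ Finsupp.supported k k (IrrSet S), g ∈ dialgIdeal S → g = 0 := by
  rw [linearIndependent_iff]
  constructor
  · intro h g hg hgS
    have hg' : (Finsupp.comapDomain Subtype.val g Subtype.val_injective.injOn :
        {u : NDiword X // u ∈ IrrSet S} →₀ k).mapDomain Subtype.val = g := by
      apply Finsupp.mapDomain_comapDomain _ Subtype.val_injective
      intro u hu
      exact ⟨⟨u, hg hu⟩, rfl⟩
    have := h _ (by rw [cd_linComb, hg']; simpa using hgS)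
    rw [← hg', this, Finsupp.mapDomain_zero]
  · intro h l hl
    rw [cd_linComb, Submodule.mkQ_apply, Submodule.Quotient.mk_eq_zero] at hl
    have := h _ (by
      classical
      intro u hu
      obtain ⟨v, _, rfl⟩ := Finset.mem_image.1 (Finsupp.mapDomain_support hu)
      exact v.2) hl
    exact Finsupp.mapDomain_injective Subtype.val_injective (by simpa using this)

theorem cd_span [WellFoundedLT X] (S : Set (FreeDialg k X)) (hmonic : ∀ f ∈ S, Monic f) :
    Submodule.span k (Set.range (irrFam S)) = ⊤ := by
  rw [eq_top_iff]
  rintro x -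
  obtain ⟨f, rfl⟩ := Submodule.mkQ_surjective _ x
  induction f using Finsupp.induction_linear with
  | zero => simp
  | add f g hf hg => rw [map_add]; exact Submodule.add_mem _ hf hg
  | single u a =>
    have : Finsupp.single u a = a • Finsupp.single u (1 : k) := by simp
    rw [this, map_smul]
    refine Submodule.smul_mem _ _ ?_
    obtain ⟨g, hg, h, hh, hgh⟩ := Submodule.mem_sup.1 (cd_reduce S hmonic u)
    rw [← hgh, map_add, (Submodule.Quotient.mk_eq_zero _).2 hh |> fun e =>
      (show (dialgIdeal S).mkQ h = 0 from e), add_zero, ← Finsupp.sum_single g, Finsupp.sum,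
      map_sum]
    refine Submodule.sum_mem _ fun v hv => ?_
    have : Finsupp.single v (g v) = g v • Finsupp.single v (1 : k) := by simp
    rw [this, map_smul]
    exact Submodule.smul_mem _ _ (Submodule.subset_span ⟨⟨v, (hg hv).1⟩, rfl⟩)

end CDHelpers

/-- Composition–Diamond lemma, (ii) ⇔ (iii): for a monic set `S`,
the leading term of every nonzero element of `Id(S)` has the form `[a[s̄]b]`
(with `[asb]` a normal `s`-diword, `s ∈ S`) if and only if the images of the
elements of `Irr(S)` form a linear basis of `D(X)/Id(S)`. -/
theorem cd_lemma_ii_iff_iii {k X : Type*} [Field k] [LinearOrder X]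
    [WellFoundedLT X] (S : Set (FreeDialg k X)) (hmonic : ∀ f ∈ S, Monic f) :
    (∀ f ∈ dialgIdeal S, f ≠ 0 → ∀ fb : NDiword X, IsMaxTerm f fb →
        ∃ s ∈ S, ∃ (c : Ctx X) (sb : NDiword X),
          IsNormalFor s c ∧ IsMaxTerm s sb ∧ fb = c.subst sb)
    ↔ (LinearIndependent k (irrFam S) ∧
        Submodule.span k (Set.range (irrFam S)) = ⊤) := by
  classical
  constructor
  · intro h
    refine ⟨(cd_li_iff S).2 fun g hg hgS => ?_, cd_span S hmonic⟩
    by_contra hne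
    obtain ⟨u, hu⟩ := cd_exists_max g hne
    obtain ⟨s, hs, c, sb, hc, hsb, he⟩ := h g hgS hne u hu
    exact hg hu.1 ⟨s, hs, c, sb, hsb, hc, he⟩
  · rintro ⟨hli, -⟩ f hf hf0 fb hfb
    rw [cd_li_iff] at hli
    by_contra hcon
    have hirr : fb ∈ IrrSet S := by
      rintro ⟨s, hs, c, sb, hsb, hc, he⟩
      exact hcon ⟨s, hs, c, sb, hc, hsb, he⟩
    let A := Finsupp.supported k k {v | v ∈ IrrSet S ∧ cdWt v < cdWt fb}
    have hr : ∑ v ∈ f.support.erase fb, f v • Finsupp.single v (1 : k) ∈ A ⊔ dialgIdeal S := by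
      refine Submodule.sum_mem _ fun v hv => Submodule.smul_mem _ _ ?_
      rw [Finset.mem_erase] at hv
      have hlt := (cd_dlt_iff _ _).1 (hfb.2 v hv.2 hv.1)
      have hle : cdN S v ≤ A ⊔ dialgIdeal S :=
        sup_le_sup_right (Finsupp.supported_mono (s := {w | w ∈ IrrSet S ∧ cdWt w ≤ cdWt v})
          (t := {w | w ∈ IrrSet S ∧ cdWt w < cdWt fb})
          fun _ hw => ⟨hw.1, hw.2.trans_lt hlt⟩) _
      exact hle (cd_reduce S hmonic v)
    obtain ⟨g, hg, h, hh, hgh⟩ := Submodule.mem_sup.1 hr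
    have hfe : f = Finsupp.single fb (f fb) +
        ∑ v ∈ f.support.erase fb, f v • Finsupp.single v (1 : k) := by
      conv_lhs => rw [← Finsupp.sum_single f, Finsupp.sum, ← Finset.add_sum_erase _ _ hfb.1]
      simp
    have hz : Finsupp.single fb (f fb) + g = 0 := by
      refine hli _ (Submodule.add_mem _ (Finsupp.single_mem_supported k _ hirr)
        (Finsupp.supported_mono (fun _ hw => hw.1) hg)) ?_
      have : Finsupp.single fb (f fb) + g = f - h := by
        rw [← hgh] at hfe
        rw [eq_sub_iff_add_eq, add_assoc]
        exact hfe.symm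
      rw [this]
      exact Submodule.sub_mem _ hf hh
    have hg0 : g fb = 0 := by
      by_contra hne
      exact lt_irrefl _ (hg (Finsupp.mem_support_iff.2 hne)).2
    have := DFunLike.congr_fun hz fb
    simp [hg0] at this
    exact Finsupp.mem_support_iff.1 hfb.1 this
end

section
/- Every dialgebra has a bar unit extension: for every dialgebra D over a field k there exist a dialgebra D₁ over k, an injective dialgebra homomorphism ι : D → D₁ (a k-linear map preserving both products ⊢ and ⊣), and an element e ∈ D₁ such that e ⊢ x = x and x ⊣ e = x for all x ∈ D₁ (i.e., e is a bar unit of D₁). -/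
universe u v

/-- A bar unit extension of a dialgebra `D`: a dialgebra `D₁` together with an
injective dialgebra homomorphism `D → D₁` and a bar unit `e ∈ D₁`. -/
structure BarUnitExtension (k : Type u) (D : Type v) [Field k] [AddCommGroup D]
    [Module k D] (dia : Dialgebra k D) where
  carrier : Type (max u v)
  [acg : AddCommGroup carrier]
  [mod : Module k carrier]
  dia' : Dialgebra k carrier
  emb : D →ₗ[k] carrier
  inj : Function.Injective emb
  map_lp : ∀ a b : D, emb (dia.lp a b) = dia'.lp (emb a) (emb b)
  map_rp : ∀ a b : D, emb (dia.rp a b) = dia'.rp (emb a) (emb b)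
  bar : carrier
  bar_lp : ∀ x : carrier, dia'.lp bar x = x
  bar_rp : ∀ x : carrier, dia'.rp x bar = x

/-- Abstract construction: from a unital algebra `U`, a unital `U`-bimodule structure on `D`
and a bimodule map `φ : D → U` inducing the dialgebra. -/
theorem barUnit_of_bimodule {k : Type u} {D : Type v} [Field k]
    [AddCommGroup D] [Module k D] (dia : Dialgebra k D)
    (U : Type (max u v)) [Ring U] [Algebra k U]
    (l r : U →ₗ[k] D →ₗ[k] D) (φ : D →ₗ[k] U)
    (l1 : ∀ x, l 1 x = x) (r1 : ∀ x, r 1 x = x)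
    (lm : ∀ u w x, l (u * w) x = l u (l w x))
    (rm : ∀ u w x, r (u * w) x = r w (r u x))
    (lr : ∀ u w x, l u (r w x) = r w (l u x))
    (fl : ∀ u x, φ (l u x) = u * φ x)
    (fr : ∀ u x, φ (r u x) = φ x * u)
    (hl : ∀ a b, dia.lp a b = l (φ a) b)
    (hr : ∀ a b, dia.rp a b = r (φ b) a) :
    Nonempty (BarUnitExtension k D dia) := by
  refine ⟨{ carrier := D × U
            dia' :=
            { lp := fun p q => (l (φ p.1 + p.2) q.1, (φ p.1 + p.2) * q.2)
              rp := fun p q => (r (φ q.1 + q.2) p.1, p.2 * (φ q.1 + q.2))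
              lp_add_left := ?_
              lp_add_right := ?_
              lp_smul_left := ?_
              lp_smul_right := ?_
              rp_add_left := ?_
              rp_add_right := ?_
              rp_smul_left := ?_
              rp_smul_right := ?_
              lp_assoc := ?_
              rp_assoc := ?_
              di1 := ?_
              di2 := ?_
              di3 := ?_ }
            emb := LinearMap.inl k D U
            inj := LinearMap.inl_injective
            map_lp := ?_
            map_rp := ?_
            bar := (0, 1)
            bar_lp := ?_
            bar_rp := ?_ }⟩
  all_goals intros
  all_goals
    ext
    all_goals
      simp [l1, r1, lm, rm, lr, fl, fr, hl, hr, mul_add, add_mul, mul_assoc, smul_add]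
    all_goals abel

/-- The pair of (left, right) multiplications. -/
def pairMul {k : Type u} {D : Type v} [Field k]
    [AddCommGroup D] [Module k D] (dia : Dialgebra k D) :
    D →ₗ[k] (Module.End k D × (Module.End k D)ᵐᵒᵖ) where
  toFun d :=
    ({ toFun := fun x => dia.lp d x
       map_add' := dia.lp_add_right d
       map_smul' := fun c x => dia.lp_smul_right c d x },
     MulOpposite.op
     { toFun := fun x => dia.rp x d
       map_add' := fun x y => dia.rp_add_left x y d
       map_smul' := fun c x => dia.rp_smul_left c x d })
  map_add' a b := by
    apply Prod.ext
    · ext x; exact dia.lp_add_left a b x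
    · apply MulOpposite.unop_injective
      ext x; exact dia.rp_add_right x a b
  map_smul' c b := by
    apply Prod.ext
    · ext x; exact dia.lp_smul_left c b x
    · apply MulOpposite.unop_injective
      ext x; exact dia.rp_smul_right c x b

theorem pairMul_fst {k : Type u} {D : Type v} [Field k]
    [AddCommGroup D] [Module k D] (dia : Dialgebra k D) (d x : D) :
    (pairMul dia d).1 x = dia.lp d x := rfl

theorem pairMul_snd {k : Type u} {D : Type v} [Field k]
    [AddCommGroup D] [Module k D] (dia : Dialgebra k D) (d x : D) :
    (pairMul dia d).2.unop x = dia.rp x d := rfl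

theorem pairMul_lp {k : Type u} {D : Type v} [Field k]
    [AddCommGroup D] [Module k D] (dia : Dialgebra k D) (a b : D) :
    pairMul dia (dia.lp a b) = pairMul dia a * pairMul dia b := by
  apply Prod.ext
  · ext x; exact dia.lp_assoc a b x
  · apply MulOpposite.unop_injective
    ext x; exact dia.di1 x a b

theorem pairMul_rp {k : Type u} {D : Type v} [Field k]
    [AddCommGroup D] [Module k D] (dia : Dialgebra k D) (a b : D) :
    pairMul dia (dia.rp a b) = pairMul dia a * pairMul dia b := by
  apply Prod.ext
  · ext x; exact dia.di2 a b x
  · apply MulOpposite.unop_injective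
    ext x; exact (dia.rp_assoc x a b).symm

/-- The range of `pairMul`, a non-unital subalgebra. -/
def pairAlg {k : Type u} {D : Type v} [Field k]
    [AddCommGroup D] [Module k D] (dia : Dialgebra k D) :
    NonUnitalSubalgebra k (Module.End k D × (Module.End k D)ᵐᵒᵖ) where
  carrier := Set.range (pairMul dia)
  add_mem' := by
    rintro _ _ ⟨a, rfl⟩ ⟨b, rfl⟩
    exact ⟨a + b, map_add _ _ _⟩
  zero_mem' := ⟨0, map_zero _⟩
  mul_mem' := by
    rintro _ _ ⟨a, rfl⟩ ⟨b, rfl⟩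
    exact ⟨dia.lp a b, pairMul_lp dia a b⟩
  smul_mem' := by
    rintro c _ ⟨a, rfl⟩
    exact ⟨c • a, map_smul _ _ _⟩

/-- Corestriction of `pairMul` to its range. -/
def toPairAlg {k : Type u} {D : Type v} [Field k]
    [AddCommGroup D] [Module k D] (dia : Dialgebra k D) : D →ₗ[k] pairAlg dia where
  toFun d := ⟨pairMul dia d, d, rfl⟩
  map_add' a b := Subtype.ext (map_add (pairMul dia) a b)
  map_smul' c b := Subtype.ext (map_smul (pairMul dia) c b)

theorem toPairAlg_surj {k : Type u} {D : Type v} [Field k]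
    [AddCommGroup D] [Module k D] (dia : Dialgebra k D) (s : pairAlg dia) :
    ∃ d, s = toPairAlg dia d := by
  obtain ⟨_, d, rfl⟩ := s
  exact ⟨d, rfl⟩

theorem toPairAlg_lp {k : Type u} {D : Type v} [Field k]
    [AddCommGroup D] [Module k D] (dia : Dialgebra k D) (a b : D) :
    toPairAlg dia (dia.lp a b) = toPairAlg dia a * toPairAlg dia b :=
  Subtype.ext (pairMul_lp dia a b)

theorem toPairAlg_rp {k : Type u} {D : Type v} [Field k]
    [AddCommGroup D] [Module k D] (dia : Dialgebra k D) (a b : D) :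
    toPairAlg dia (dia.rp a b) = toPairAlg dia a * toPairAlg dia b :=
  Subtype.ext (pairMul_rp dia a b)

/-- Left action. -/
def lAct {k : Type u} {D : Type v} [Field k]
    [AddCommGroup D] [Module k D] (dia : Dialgebra k D) :
    Unitization k (pairAlg dia) →ₗ[k] D →ₗ[k] D where
  toFun w := w.fst • LinearMap.id + (w.snd : Module.End k D × (Module.End k D)ᵐᵒᵖ).1
  map_add' a b := by ext x; simp [add_smul]; abel
  map_smul' c b := by ext x; simp [mul_smul]

/-- Right action. -/
def rAct {k : Type u} {D : Type v} [Field k]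
    [AddCommGroup D] [Module k D] (dia : Dialgebra k D) :
    Unitization k (pairAlg dia) →ₗ[k] D →ₗ[k] D where
  toFun w := w.fst • LinearMap.id + (w.snd : Module.End k D × (Module.End k D)ᵐᵒᵖ).2.unop
  map_add' a b := by ext x; simp [add_smul]; abel
  map_smul' c b := by ext x; simp [mul_smul]

theorem lAct_apply {k : Type u} {D : Type v} [Field k]
    [AddCommGroup D] [Module k D] (dia : Dialgebra k D) (c : k) (d x : D) :
    lAct dia (Unitization.inl c + Unitization.inr (toPairAlg dia d)) x
      = c • x + dia.lp d x := by
  simp [lAct]; rfl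

theorem rAct_apply {k : Type u} {D : Type v} [Field k]
    [AddCommGroup D] [Module k D] (dia : Dialgebra k D) (c : k) (d x : D) :
    rAct dia (Unitization.inl c + Unitization.inr (toPairAlg dia d)) x
      = c • x + dia.rp x d := by
  simp [rAct]; rfl

theorem uni_form {k : Type u} {D : Type v} [Field k]
    [AddCommGroup D] [Module k D] (dia : Dialgebra k D) (w : Unitization k (pairAlg dia)) :
    ∃ (c : k) (d : D), w = Unitization.inl c + Unitization.inr (toPairAlg dia d) := by
  obtain ⟨d, hd⟩ := toPairAlg_surj dia w.snd
  exact ⟨w.fst, d, by rw [← hd, Unitization.inl_fst_add_inr_snd_eq]⟩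

theorem uni_mul {k : Type u} {D : Type v} [Field k]
    [AddCommGroup D] [Module k D] (dia : Dialgebra k D) (c c' : k) (d d' : D) :
    ((Unitization.inl c + Unitization.inr (toPairAlg dia d)) *
      (Unitization.inl c' + Unitization.inr (toPairAlg dia d')) : Unitization k (pairAlg dia))
    = Unitization.inl (c * c') +
      Unitization.inr (toPairAlg dia (c • d' + c' • d + dia.lp d d')) := by
  rw [map_add, map_add, map_smul, map_smul, toPairAlg_lp]
  ext <;> simp

/-- STATEMENT 17: every dialgebra has a bar unit extension. -/
theorem exists_bar_unit_extension {k : Type u} {D : Type v} [Field k]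
    [AddCommGroup D] [Module k D] (dia : Dialgebra k D) :
    Nonempty (BarUnitExtension k D dia) := by
  refine barUnit_of_bimodule dia (Unitization k (pairAlg dia)) (lAct dia) (rAct dia)
    ((Unitization.inrHom k k (pairAlg dia)).comp (toPairAlg dia)) ?_ ?_ ?_ ?_ ?_ ?_ ?_ ?_ ?_
  · intro x; simp [lAct]
  · intro x; simp [rAct]
  · intro u w x
    obtain ⟨c, d, rfl⟩ := uni_form dia u
    obtain ⟨c', d', rfl⟩ := uni_form dia w
    rw [uni_mul]
    simp only [lAct_apply, dia.lp_add_left, dia.lp_add_right, dia.lp_smul_left,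
      dia.lp_smul_right, dia.lp_assoc]
    module
  · intro u w x
    obtain ⟨c, d, rfl⟩ := uni_form dia u
    obtain ⟨c', d', rfl⟩ := uni_form dia w
    rw [uni_mul]
    simp only [rAct_apply, dia.rp_add_left, dia.rp_add_right, dia.rp_smul_left,
      dia.rp_smul_right, dia.di1]
    module
  · intro u w x
    obtain ⟨c, d, rfl⟩ := uni_form dia u
    obtain ⟨c', d', rfl⟩ := uni_form dia w
    simp only [lAct_apply, rAct_apply, dia.rp_add_left, dia.lp_add_right, dia.rp_smul_left,
      dia.lp_smul_right, dia.di3]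
    module
  · intro u x
    obtain ⟨c, d, rfl⟩ := uni_form dia u
    rw [lAct_apply]
    simp only [LinearMap.comp_apply, map_add, map_smul, toPairAlg_lp]
    ext <;> simp
  · intro u x
    obtain ⟨c, d, rfl⟩ := uni_form dia u
    rw [rAct_apply]
    simp only [LinearMap.comp_apply, map_add, map_smul, toPairAlg_rp]
    ext <;> simp
  · intro a b
    have := lAct_apply dia 0 a b
    simp at this
    simp [this]
  · intro a b
    have := rAct_apply dia 0 b a
    simp at this
    simp [this]
end
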